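/- Let N ≥ 2 be an integer and k ≥ 2 an even integer, and let B_{k,N} be the (N⁺+1)×(N⁺+1) matrix with (i,j)-entry B̃_k(ij/N) for 0 ≤ i,j ≤ N⁺. Then det(B_{k,N}) = (−1)^{N⁺(N⁺+1)/2} · N^{(N⁺+1)/2} · 2^{N⁺+1−N⁻} · ∏_{d | N} ∏_{χ even mod d} ( (−1)^{k/2+1}·k!/(2π)^k · L(k,χ) ), where the inner product runs over all Dirichlet characters χ modulo d with χ(−1) = 1; for d = 1 the only character is trivial and L(k,χ) = ζ(k), the Riemann zeta value. -/

import Mathlib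

open scoped Classical in
/-- The periodic Bernoulli function `B̃_k(x) = B_k({x})`, with the convention
`B̃_1(x) = 0` for integer `x`. -/
noncomputable def periodicBernoulli (k : ℕ) (x : ℝ) : ℝ :=
  if k = 1 ∧ Int.fract x = 0 then 0
  else Polynomial.aeval (Int.fract x) (Polynomial.bernoulli k)

/-- For even `k`, the Bernoulli matrix `B_{k,N} = (B̃_k(ij/N))_{0 ≤ i,j ≤ N⁺}`,
where `N⁺ = ⌊N/2⌋`. -/
noncomputable def bernoulliMatrixEven (k N : ℕ) :
    Matrix (Fin (N / 2 + 1)) (Fin (N / 2 + 1)) ℝ :=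
  Matrix.of fun i j => periodicBernoulli k (((i : ℕ) * (j : ℕ) : ℕ) / (N : ℝ))

open scoped Classical in
/-- `∏_{χ even mod n} ((−1)^{k/2+1}·k!/(2π)^k · L(k,χ))`, the product running over all
Dirichlet characters `χ` mod `n` with `χ(−1) = 1`.  For `n = 1` the only character is
trivial and `L(k,χ) = ζ(k)`.  (The value for `n = 0` is irrelevant and set to `1`.) -/
noncomputable def evenCharLProd (k : ℕ) : ℕ → ℂ
  | 0 => 1
  | (n + 1) =>
      ∏ χ : DirichletCharacter ℂ (n + 1),
        if χ (-1) = 1 then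
          ((-1 : ℂ) ^ (k / 2 + 1) * (Nat.factorial k) / (2 * Real.pi) ^ k) *
            DirichletCharacter.LFunction χ k
        else 1

open Matrix Finset

namespace ZMod

/-- The representative of `a : ZMod N` in `{0, …, ⌊N/2⌋}` modulo sign. -/
def absRep (N : ℕ) [NeZero N] (a : ZMod N) : Fin (N / 2 + 1) :=
  ⟨a.valMinAbs.natAbs, Nat.lt_succ_of_le (natAbs_valMinAbs_le a)⟩

variable {N : ℕ} [NeZero N]

lemma absRep_cases (a : ZMod N) :
    (((absRep N a : ℕ) : ZMod N) = a) ∨ (((absRep N a : ℕ) : ZMod N) = -a) := by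
  have h := coe_valMinAbs a
  rcases Int.natAbs_eq a.valMinAbs with h' | h'
  · left
    rwa [h', Int.cast_natCast] at h
  · right
    rw [h', Int.cast_neg, Int.cast_natCast] at h
    exact (neg_eq_iff_eq_neg.1 h)

lemma absRep_natCast (i : Fin (N / 2 + 1)) : absRep N ((i : ℕ) : ZMod N) = i := by
  ext
  simp [absRep, valMinAbs_natCast_of_le_half (Nat.le_of_lt_succ i.2)]

lemma absRep_neg (a : ZMod N) : absRep N (-a) = absRep N a := by
  ext
  exact natAbs_valMinAbs_neg a

lemma absRep_eq_iff (a : ZMod N) (i : Fin (N / 2 + 1)) :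
    absRep N a = i ↔ a = (i : ℕ) ∨ a = -((i : ℕ) : ZMod N) := by
  constructor
  · rintro rfl
    rcases absRep_cases a with h | h
    · exact Or.inl h.symm
    · right
      rw [h, neg_neg]
  · rintro (h | h)
    · rw [h, absRep_natCast]
    · rw [h, absRep_neg, absRep_natCast]

lemma apply_absRep {α : Type*} {f : ZMod N → α} (hf : ∀ a, f (-a) = f a) (a : ZMod N) :
    f ((absRep N a : ℕ) : ZMod N) = f a := by
  rcases absRep_cases a with h | h <;> rw [h]
  exact hf a

/-- The even part of the standard additive character, `j ↦ cos (2πj/N)`. -/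
noncomputable def cosChar (a : ZMod N) : ℂ := (stdAddChar a + stdAddChar (-a)) / 2

lemma cosChar_neg (a : ZMod N) : cosChar (-a) = cosChar a := by
  simp [cosChar, add_comm]

lemma cosChar_natCast (m : ℕ) :
    cosChar (m : ZMod N) = (Real.cos (2 * Real.pi * m / N) : ℂ) := by
  have h1 := stdAddChar_coe (N := N) m
  have h2 := stdAddChar_coe (N := N) (-m)
  push_cast at h1 h2
  rw [cosChar, h1, h2, Complex.ofReal_cos, Complex.cos]
  push_cast
  congr 3 <;> ring

lemma sum_cosChar_mul_cosChar (x y : ZMod N) :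
    ∑ a : ZMod N, cosChar (x * a) * cosChar (a * y) =
      (N : ℂ) / 2 * ((if x = y then 1 else 0) + (if x = -y then 1 else 0)) := by
  have key (b : ZMod N) : ∑ a : ZMod N, (stdAddChar (a * b) : ℂ) = if b = 0 then (N : ℂ) else 0 := by
    rw [AddChar.sum_mulShift b (isPrimitive_stdAddChar N), ZMod.card]
    split_ifs <;> simp
  have hterm (a : ZMod N) : cosChar (x * a) * cosChar (a * y) =
      (stdAddChar (a * (x + y)) + stdAddChar (a * (x - y)) + stdAddChar (a * (-x + y)) +
        stdAddChar (a * (-x - y))) / 4 := by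
    have e1 : a * (x + y) = x * a + a * y := by ring
    have e2 : a * (x - y) = x * a + -(a * y) := by ring
    have e3 : a * (-x + y) = -(x * a) + a * y := by ring
    have e4 : a * (-x - y) = -(x * a) + -(a * y) := by ring
    rw [e1, e2, e3, e4]
    simp only [cosChar, AddChar.map_add_eq_mul]
    ring
  simp_rw [hterm, ← Finset.sum_div, Finset.sum_add_distrib, key]
  have e1 : x + y = 0 ↔ x = -y := by grind
  have e2 : x - y = 0 ↔ x = y := by grind
  have e3 : -x + y = 0 ↔ x = y := by grind
  have e4 : -x - y = 0 ↔ x = -y := by grind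
  simp only [e1, e2, e3, e4]
  split_ifs <;> ring

end ZMod

section CosineMatrix

open ZMod

/-- The cosine matrix `(cos (2πij/N))` for `0 ≤ i, j ≤ ⌊N/2⌋`. -/
noncomputable def cosMatrix (N : ℕ) : Matrix (Fin (N / 2 + 1)) (Fin (N / 2 + 1)) ℝ :=
  Matrix.of fun i j => Real.cos (2 * Real.pi * ((i : ℕ) * (j : ℕ) : ℕ) / N)

variable {N : ℕ} [NeZero N]

lemma cosMatrix_apply (i j : Fin (N / 2 + 1)) :
    (cosMatrix N i j : ℂ) = cosChar (((i : ℕ) : ZMod N) * ((j : ℕ) : ZMod N)) := by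
  rw [← Nat.cast_mul, cosChar_natCast]
  simp [cosMatrix]

/-- The size of the orbit of `i` under negation on `ZMod N`. -/
def orbitSize (N : ℕ) (i : Fin (N / 2 + 1)) : ℕ :=
  if 2 * (i : ℕ) = 0 ∨ 2 * (i : ℕ) = N then 1 else 2

lemma natCast_eq_neg_natCast_iff {N : ℕ} (hN : 2 ≤ N) (i j : Fin (N / 2 + 1)) :
    ((i : ℕ) : ZMod N) = -((j : ℕ) : ZMod N) ↔ i = j ∧ (2 * (i : ℕ) = 0 ∨ 2 * (i : ℕ) = N) := by
  have hi := i.2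
  have hj := j.2
  rw [eq_neg_iff_add_eq_zero, ← Nat.cast_add, natCast_eq_zero_iff, Fin.ext_iff]
  constructor
  · rintro ⟨c, hc⟩
    have : c < 2 := by
      by_contra! h
      have : N * 2 ≤ N * c := Nat.mul_le_mul_left _ h
      omega
    interval_cases c <;> omega
  · rintro ⟨h, h' | h'⟩
    · rw [show (i : ℕ) + j = 0 by omega]
      exact dvd_zero _
    · rw [show (i : ℕ) + j = N by omega]

lemma natCast_inj_of_le_half (i j : Fin (N / 2 + 1)) :
    ((i : ℕ) : ZMod N) = ((j : ℕ) : ZMod N) ↔ i = j :=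
  ⟨fun h => by rw [← absRep_natCast i, h, absRep_natCast], fun h => by rw [h]⟩

lemma card_absRep_fiber (hN : 2 ≤ N) (i : Fin (N / 2 + 1)) :
    #{a : ZMod N | absRep N a = i} = orbitSize N i := by
  have : ({a : ZMod N | absRep N a = i} : Finset (ZMod N)) =
      {((i : ℕ) : ZMod N), -((i : ℕ) : ZMod N)} := by
    ext a
    simp [absRep_eq_iff]
  rw [this, orbitSize]
  have h := natCast_eq_neg_natCast_iff hN i i
  split_ifs with h'
  · rw [← h.2 ⟨rfl, h'⟩]
    simp
  · exact Finset.card_pair fun e => h' (h.1 e).2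

lemma prod_orbitSize {N : ℕ} (hN : 2 ≤ N) : ∏ i, orbitSize N i = 2 ^ ((N - 1) / 2) := by
  have h1 : ∏ i, orbitSize N i =
      ∏ i ∈ Finset.range (N / 2 + 1), if 2 * i = 0 ∨ 2 * i = N then 1 else 2 :=
    Fin.prod_univ_eq_prod_range (fun i => if 2 * i = 0 ∨ 2 * i = N then 1 else 2) _
  rw [h1, Finset.prod_ite, Finset.prod_const_one, one_mul, Finset.prod_const]
  have h2 : ({x ∈ Finset.range (N / 2 + 1) | ¬(2 * x = 0 ∨ 2 * x = N)}) =
      Finset.Icc 1 ((N - 1) / 2) := by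
    ext x
    simp only [Finset.mem_filter, Finset.mem_range, Finset.mem_Icc]
    omega
  rw [h2]
  simp

lemma cosMatrix_mul_diagonal_mul_cosMatrix (hN : 2 ≤ N) :
    cosMatrix N * diagonal (fun i => (orbitSize N i : ℝ)) * cosMatrix N *
      diagonal (fun i => (orbitSize N i : ℝ)) = (N : ℝ) • 1 := by
  ext i j
  apply Complex.ofReal_injective
  simp only [Matrix.mul_diagonal, Matrix.mul_apply (M := cosMatrix N * _), Matrix.smul_apply,
    Matrix.one_apply, smul_eq_mul]
  push_cast
  simp only [cosMatrix_apply]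
  have h1 : ∑ l : Fin (N / 2 + 1), cosChar (((i : ℕ) : ZMod N) * ((l : ℕ) : ZMod N)) *
      (orbitSize N l : ℂ) * cosChar (((l : ℕ) : ZMod N) * ((j : ℕ) : ZMod N)) =
      ∑ a : ZMod N, cosChar (((i : ℕ) : ZMod N) * a) * cosChar (a * ((j : ℕ) : ZMod N)) := by
    rw [← Finset.sum_fiberwise (s := Finset.univ) (g := absRep N)]
    refine Finset.sum_congr rfl fun l _ => ?_
    rw [← card_absRep_fiber hN l, mul_right_comm, mul_comm, ← nsmul_eq_mul, ← Finset.sum_const]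
    refine Finset.sum_congr rfl fun a ha => ?_
    rw [Finset.mem_filter] at ha
    rw [← ha.2]
    refine apply_absRep (f := fun a => cosChar (((i : ℕ) : ZMod N) * a) *
      cosChar (a * ((j : ℕ) : ZMod N))) (fun a => ?_) a
    simp only [mul_neg, neg_mul, cosChar_neg]
  rw [h1, sum_cosChar_mul_cosChar]
  simp only [natCast_inj_of_le_half, natCast_eq_neg_natCast_iff hN]
  by_cases h : i = j
  · subst h
    by_cases h' : 2 * (i : ℕ) = 0 ∨ 2 * (i : ℕ) = N
    · simp only [orbitSize, h', and_self, if_true]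
      push_cast
      ring
    · simp only [orbitSize, h', and_false, if_true, if_false]
      push_cast
      ring
  · simp [h]

lemma det_cosMatrix_sq (hN : 2 ≤ N) :
    ((cosMatrix N).det * 2 ^ ((N - 1) / 2)) ^ 2 = (N : ℝ) ^ (N / 2 + 1) := by
  have h := congrArg Matrix.det (cosMatrix_mul_diagonal_mul_cosMatrix hN)
  have h2 : ∏ i, (orbitSize N i : ℝ) = 2 ^ ((N - 1) / 2) := mod_cast prod_orbitSize hN
  rw [Matrix.det_mul, Matrix.det_mul, Matrix.det_mul, Matrix.det_diagonal, h2, Matrix.det_smul,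
    Matrix.det_one, Fintype.card_fin, mul_one] at h
  rw [← h]
  ring

lemma sign_mul_det_cosMatrix_nonneg :
    0 ≤ (-1) ^ (N / 2 * (N / 2 + 1) / 2) * (cosMatrix N).det := by
  set v : Fin (N / 2 + 1) → ℝ := fun i => Real.cos (2 * Real.pi * (i : ℕ) / N) with hv
  have hC : cosMatrix N = Matrix.of fun i j : Fin (N / 2 + 1) =>
      (Polynomial.Chebyshev.T ℝ ((j : ℕ) : ℤ)).eval (v i) := by
    ext i j
    simp only [hv, Matrix.of_apply, Polynomial.Chebyshev.T_real_cos, cosMatrix]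
    congr 1
    push_cast
    ring
  have hN0 : (0 : ℝ) < N := by exact_mod_cast NeZero.pos N
  have hdeg (j : Fin (N / 2 + 1)) :
      (Polynomial.Chebyshev.T ℝ ((j : ℕ) : ℤ)).natDegree = (j : ℕ) := by
    simp [Polynomial.Chebyshev.natDegree_T]
  rw [hC, Matrix.eval_matrixOfPolynomials_eq_vandermonde_mul_matrixOfPolynomials v _
    (fun j => (hdeg j).le), Matrix.det_mul, ← mul_assoc]
  refine mul_nonneg ?_ ?_
  · rw [Matrix.det_vandermonde]
    have hc : ∏ i : Fin (N / 2 + 1), ∏ j ∈ Finset.Ioi i, (-1 : ℝ) =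
        (-1) ^ (N / 2 * (N / 2 + 1) / 2) := by
      simp_rw [Finset.prod_const, Fin.card_Ioi]
      rw [Finset.prod_pow_eq_pow_sum]
      congr 1
      rw [Fin.sum_univ_eq_sum_range (fun i => N / 2 + 1 - 1 - i), Finset.sum_range_reflect
        (fun i => i), Finset.sum_range_id, Nat.add_sub_cancel, mul_comm]
    rw [← hc, ← Finset.prod_mul_distrib]
    refine Finset.prod_nonneg fun i _ => ?_
    rw [← Finset.prod_mul_distrib]
    refine Finset.prod_nonneg fun j hj => ?_
    have hij : (i : ℕ) < j := Fin.lt_def.1 (Finset.mem_Ioi.1 hj)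
    suffices v j ≤ v i by linarith
    refine Real.cos_le_cos_of_nonneg_of_le_pi (by positivity) ?_ ?_
    · rw [div_le_iff₀ hN0]
      have : 2 * (j : ℕ) ≤ N := by have := j.2; omega
      have : (2 : ℝ) * (j : ℕ) ≤ N := by exact_mod_cast this
      nlinarith [Real.pi_pos]
    · gcongr
  · rw [Matrix.det_of_isUpperTriangular]
    · refine Finset.prod_nonneg fun i _ => ?_
      have : (Polynomial.Chebyshev.T ℝ ((i : ℕ) : ℤ)).coeff (i : ℕ) =
          (Polynomial.Chebyshev.T ℝ ((i : ℕ) : ℤ)).leadingCoeff := by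
        rw [Polynomial.leadingCoeff, hdeg]
      simp only [Matrix.of_apply]
      rw [this, Polynomial.Chebyshev.leadingCoeff_T]
      positivity
    · intro i j hij
      exact Polynomial.coeff_eq_zero_of_natDegree_lt (by rw [hdeg]; exact hij)

lemma det_cosMatrix (hN : 2 ≤ N) :
    (cosMatrix N).det * 2 ^ ((N - 1) / 2) =
      (-1) ^ (N / 2 * (N / 2 + 1) / 2) * Real.sqrt N ^ (N / 2 + 1) := by
  set e := N / 2 * (N / 2 + 1) / 2
  have hsq : ((-1 : ℝ) ^ e) * (-1) ^ e = 1 := by rw [← mul_pow]; simp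
  have h : (-1) ^ e * ((cosMatrix N).det * 2 ^ ((N - 1) / 2)) = Real.sqrt N ^ (N / 2 + 1) := by
    rw [← sq_eq_sq₀ _ (by positivity), mul_pow, det_cosMatrix_sq hN, ← pow_mul, mul_comm e,
      pow_mul, ← pow_mul (Real.sqrt N), mul_comm _ 2, pow_mul, Real.sq_sqrt (by positivity)]
    · simp
    · rw [← mul_assoc]
      exact mul_nonneg sign_mul_det_cosMatrix_nonneg (by positivity)
  rw [← h, ← mul_assoc, hsq, one_mul]

end CosineMatrix

section DirichletMatrix

open ZMod

lemma natCast_eq_or_eq_neg_iff {N a b : ℕ} :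
    ((a : ZMod N) = b ∨ (a : ZMod N) = -b) ↔ (N : ℤ) ∣ a - b ∨ (N : ℤ) ∣ a + b := by
  refine or_congr ?_ ?_
  · rw [← intCast_zmod_eq_zero_iff_dvd]
    push_cast
    rw [sub_eq_zero]
  · rw [← intCast_zmod_eq_zero_iff_dvd]
    push_cast
    rw [eq_neg_iff_add_eq_zero]

lemma natCast_mul_eq_or_eq_neg_iff {g d a b : ℕ} (hg : g ≠ 0) :
    (((g * a : ℕ) : ZMod (g * d)) = (g * b : ℕ) ∨ ((g * a : ℕ) : ZMod (g * d)) = -(g * b : ℕ)) ↔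
      ((a : ZMod d) = b ∨ (a : ZMod d) = -b) := by
  have hg' : (g : ℤ) ≠ 0 := by exact_mod_cast hg
  rw [natCast_eq_or_eq_neg_iff, natCast_eq_or_eq_neg_iff]
  push_cast
  rw [← mul_sub, ← mul_add, mul_dvd_mul_iff_left hg', mul_dvd_mul_iff_left hg']

lemma summable_ite_one_div_pow {k : ℕ} (hk : 2 ≤ k) (p : ℕ → Prop) [DecidablePred p] :
    Summable fun n : ℕ => if p n then 1 / (n : ℂ) ^ k else 0 := by
  refine Summable.of_norm_bounded (g := fun n : ℕ => 1 / (n : ℝ) ^ k)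
    (Real.summable_one_div_nat_pow.2 hk) fun n => ?_
  split_ifs
  · simp
  · simp

/-- The matrix of the operator `∑ n⁻ᵏ [n]` on even functions on `ZMod N`, where `[n]` is
precomposition with multiplication by `n`. -/
noncomputable def dirichletMatrix (k N : ℕ) [NeZero N] :
    Matrix (Fin (N / 2 + 1)) (Fin (N / 2 + 1)) ℂ :=
  Matrix.of fun i l =>
    ∑' n : ℕ, if absRep N ((n * (i : ℕ) : ℕ) : ZMod N) = l then 1 / (n : ℂ) ^ k else 0

lemma sum_dirichletMatrix_mul {N k : ℕ} [NeZero N] (hk : 2 ≤ k) (i : Fin (N / 2 + 1))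
    {ι : Type*} [Fintype ι] (r : ι → Fin (N / 2 + 1)) (F : ι → ℂ) :
    ∑ l, dirichletMatrix k N i (r l) * F l =
      ∑' n : ℕ, 1 / (n : ℂ) ^ k *
        ∑ l, if absRep N ((n * (i : ℕ) : ℕ) : ZMod N) = r l then F l else 0 := by
  have h (l : ι) : Summable fun n : ℕ =>
      (if absRep N ((n * (i : ℕ) : ℕ) : ZMod N) = r l then 1 / (n : ℂ) ^ k else 0) * F l :=
    (summable_ite_one_div_pow hk _).mul_right _
  simp only [dirichletMatrix, Matrix.of_apply]
  simp_rw [← tsum_mul_right]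
  rw [← Summable.tsum_finsetSum fun l _ => h l]
  refine tsum_congr fun n => ?_
  rw [Finset.mul_sum]
  refine Finset.sum_congr rfl fun l _ => ?_
  split_ifs <;> simp

lemma gcd_dvd_of_absRep_eq {N n : ℕ} [NeZero N] {i l : Fin (N / 2 + 1)}
    (h : absRep N ((n * (i : ℕ) : ℕ) : ZMod N) = l) :
    Nat.gcd i N ∣ Nat.gcd l N := by
  refine Nat.dvd_gcd ?_ (Nat.gcd_dvd_right _ _)
  have h1 : ((Nat.gcd i N : ℕ) : ℤ) ∣ (N : ℤ) := by exact_mod_cast Nat.gcd_dvd_right _ _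
  have h2 : ((Nat.gcd i N : ℕ) : ℤ) ∣ ((n * (i : ℕ) : ℕ) : ℤ) := by
    exact_mod_cast (Nat.gcd_dvd_left _ _).mul_left n
  rw [absRep_eq_iff, natCast_eq_or_eq_neg_iff] at h
  have : ((Nat.gcd i N : ℕ) : ℤ) ∣ ((l : ℕ) : ℤ) := by
    rcases h with h | h
    · exact (dvd_sub_right h2).1 (h1.trans h)
    · exact (dvd_add_right h2).1 (h1.trans h)
  exact_mod_cast this

lemma blockTriangular_dirichletMatrix (k N : ℕ) [NeZero N] :
    (dirichletMatrix k N).BlockTriangular fun i => Nat.gcd i N := by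
  intro i l hil
  have hpos : 0 < Nat.gcd l N := Nat.gcd_pos_of_pos_right _ (NeZero.pos N)
  simp only [dirichletMatrix, Matrix.of_apply]
  have h (n : ℕ) : ¬absRep N ((n * (i : ℕ) : ℕ) : ZMod N) = l := fun h =>
    absurd (Nat.le_of_dvd hpos (gcd_dvd_of_absRep_eq h)) (not_le.2 hil)
  simp only [h, if_false, tsum_zero]

section Block

variable {g d : ℕ}

/-- The indices in `{0, …, ⌊N/2⌋}`, `N = g * d`, whose gcd with `N` is `g`. -/
abbrev GcdIndex (g d : ℕ) : Type := {i : Fin (g * d / 2 + 1) // Nat.gcd i (g * d) = g}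

/-- The even Dirichlet characters modulo `d`. -/
abbrev EvenCharacter (d : ℕ) : Type := {χ : DirichletCharacter ℂ d // χ.Even}

noncomputable instance [NeZero d] : Fintype (EvenCharacter d) := Fintype.ofFinite _

noncomputable instance : DecidableEq (EvenCharacter d) := Classical.decEq _

lemma GcdIndex.exists_eq_mul (i : GcdIndex g d) (hg : g ≠ 0) :
    ∃ m : ℕ, (i.1 : ℕ) = g * m ∧ (i.1 : ℕ) / g = m ∧ IsUnit (m : ZMod d) := by
  obtain ⟨m, hm⟩ : g ∣ (i.1 : ℕ) := by
    conv_lhs => rw [← i.2]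
    exact Nat.gcd_dvd_left _ _
  refine ⟨m, hm, by rw [hm, Nat.mul_div_cancel_left _ (Nat.pos_of_ne_zero hg)], ?_⟩
  have h := i.2
  rw [hm, Nat.gcd_mul_left] at h
  rw [isUnit_iff_coprime]
  exact Nat.eq_of_mul_eq_mul_left (Nat.pos_of_ne_zero hg) (by rw [h, mul_one])

variable [NeZero (g * d)]

lemma absRep_mul_congr (hg : g ≠ 0) {a b : ℕ}
    (h : (a : ZMod d) = b ∨ (a : ZMod d) = -b) :
    absRep (g * d) ((g * a : ℕ) : ZMod (g * d)) = absRep (g * d) ((g * b : ℕ) : ZMod (g * d)) := by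
  rcases (natCast_mul_eq_or_eq_neg_iff hg).2 h with h | h
  · rw [h]
  · rw [h, absRep_neg]

variable [NeZero d]

lemma sum_ite_absRep_eq (hg : g ≠ 0) (χ : EvenCharacter d) (m : ℕ) :
    ∑ l : GcdIndex g d, (if absRep (g * d) ((g * m : ℕ) : ZMod (g * d)) = l.1 then
      χ.1 (((l.1 : ℕ) / g : ℕ) : ZMod d) else 0) = χ.1 (m : ZMod d) := by
  by_cases hm : IsUnit (m : ZMod d)
  · set l := absRep (g * d) ((g * m : ℕ) : ZMod (g * d)) with hl
    have hrep := (absRep_eq_iff _ _).1 hl.symm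
    obtain ⟨l', hl'⟩ : g ∣ (l : ℕ) := by
      have hrep' := natCast_eq_or_eq_neg_iff.1 hrep
      push_cast at hrep'
      have : (g : ℤ) ∣ (l : ℕ) := by
        rcases hrep' with h | h
        · exact (dvd_sub_right (dvd_mul_right _ _)).1 ((dvd_mul_right _ _).trans h)
        · exact (dvd_add_right (dvd_mul_right _ _)).1 ((dvd_mul_right _ _).trans h)
      exact_mod_cast this
    rw [hl', natCast_mul_eq_or_eq_neg_iff hg] at hrep
    have hu : IsUnit (l' : ZMod d) := by
      rcases hrep with h | h
      · rwa [← h]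
      · rwa [h, IsUnit.neg_iff] at hm
    have hgcd : Nat.gcd l (g * d) = g := by
      rw [hl', Nat.gcd_mul_left, (isUnit_iff_coprime _ _).1 hu, mul_one]
    rw [Finset.sum_eq_single (⟨l, hgcd⟩ : GcdIndex g d)]
    · rw [if_pos rfl]
      simp only [hl', Nat.mul_div_cancel_left _ (Nat.pos_of_ne_zero hg)]
      rcases hrep with h | h
      · rw [h]
      · rw [h, χ.2.eval_neg]
    · intro b _ hb
      exact if_neg fun h => hb (Subtype.ext h.symm)
    · simp
  · rw [MulChar.map_nonunit _ hm]
    refine Finset.sum_eq_zero fun l _ => if_neg fun h => hm ?_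
    obtain ⟨l', hl', -, hu⟩ := l.exists_eq_mul hg
    rw [absRep_eq_iff, hl', natCast_mul_eq_or_eq_neg_iff hg] at h
    rcases h with h | h
    · rwa [h]
    · rwa [h, IsUnit.neg_iff]

/-- The values of the even characters modulo `d` at the indices of gcd `g` with `g * d`. -/
noncomputable def charMatrix (g d : ℕ) : Matrix (GcdIndex g d) (EvenCharacter d) ℂ :=
  Matrix.of fun i χ => χ.1 (((i.1 : ℕ) / g : ℕ) : ZMod d)

/-- The inverse of `charMatrix g d`. -/
noncomputable def charMatrixInv (g d : ℕ) [NeZero d] [NeZero (g * d)] :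
    Matrix (EvenCharacter d) (GcdIndex g d) ℂ :=
  Matrix.of fun χ i => (d.totient : ℂ)⁻¹ *
    ∑ a : ZMod d, if absRep (g * d) ((g * a.val : ℕ) : ZMod (g * d)) = i.1 then χ.1⁻¹ a else 0

lemma charMatrixInv_mul_charMatrix (hg : g ≠ 0) : charMatrixInv g d * charMatrix g d = 1 := by
  ext χ ψ
  have hd : (d.totient : ℂ) ≠ 0 := by
    exact_mod_cast (Nat.totient_pos.2 (NeZero.pos d)).ne'
  simp only [Matrix.mul_apply, charMatrixInv, charMatrix, Matrix.of_apply]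
  simp_rw [mul_assoc, ← Finset.mul_sum, Finset.sum_mul]
  rw [Finset.sum_comm]
  have h (a : ZMod d) : ∑ i : GcdIndex g d,
      (if absRep (g * d) ((g * a.val : ℕ) : ZMod (g * d)) = i.1 then χ.1⁻¹ a else 0) *
        ψ.1 (((i.1 : ℕ) / g : ℕ) : ZMod d) = (χ.1⁻¹ * ψ.1) a := by
    rw [MulChar.mul_apply]
    have := sum_ite_absRep_eq hg ψ a.val
    rw [natCast_zmod_val] at this
    rw [← this, Finset.mul_sum]
    refine Finset.sum_congr rfl fun i _ => ?_
    split_ifs <;> simp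
  simp_rw [h]
  by_cases hχ : χ = ψ
  · subst hχ
    rw [inv_mul_cancel, MulChar.sum_one_eq_card_units, card_units_eq_totient, Matrix.one_apply_eq,
      inv_mul_cancel₀ hd]
  · rw [MulChar.sum_eq_zero_of_ne_one, Matrix.one_apply_ne hχ, mul_zero]
    rw [Ne, inv_mul_eq_one]
    exact fun h => hχ (Subtype.ext h)

lemma sum_mul_inv {v : ZMod d} (hv : IsUnit v) (a : ZMod d) :
    ∑ χ : DirichletCharacter ℂ d, χ v * χ⁻¹ a = if a = v then (d.totient : ℂ) else 0 := by
  obtain ⟨u, rfl⟩ := hv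
  simp_rw [eq_comm (a := a)]
  rw [← DirichletCharacter.sum_char_inv_mul_char_eq ℂ u.isUnit a,
    ← Equiv.sum_comp (Equiv.inv (DirichletCharacter ℂ d))]
  refine Finset.sum_congr rfl fun χ _ => ?_
  simp [MulChar.inv_apply]

lemma sum_evenCharacter_mul_inv {v : ZMod d} (hv : IsUnit v) (a : ZMod d) :
    ∑ χ : EvenCharacter d, χ.1 v * χ.1⁻¹ a =
      (d.totient : ℂ) / 2 * ((if a = v then 1 else 0) + if a = -v then 1 else 0) := by
  classical
  have h1 : ∑ χ : EvenCharacter d, χ.1 v * χ.1⁻¹ a =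
      ∑ χ : DirichletCharacter ℂ d, (χ v * χ⁻¹ a + χ (-v) * χ⁻¹ a) / 2 := by
    rw [← Finset.sum_subtype ({χ | χ.Even} : Finset (DirichletCharacter ℂ d)) (by simp)
      fun χ => χ v * χ⁻¹ a, Finset.sum_filter]
    refine Finset.sum_congr rfl fun χ _ => ?_
    rcases χ.even_or_odd with h | h
    · rw [if_pos h, h.eval_neg]
      ring
    · rw [if_neg fun h' => DirichletCharacter.Even.not_odd _ h' h, h.eval_neg]
      ring
  rw [h1, ← Finset.sum_div, Finset.sum_add_distrib, sum_mul_inv hv, sum_mul_inv hv.neg]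
  split_ifs <;> ring

lemma charMatrix_mul_charMatrixInv (hg : g ≠ 0) : charMatrix g d * charMatrixInv g d = 1 := by
  ext i j
  rw [Matrix.one_apply]
  have hd : (d.totient : ℂ) ≠ 0 := by
    exact_mod_cast (Nat.totient_pos.2 (NeZero.pos d)).ne'
  obtain ⟨m, hm, hm', hu⟩ := i.exists_eq_mul hg
  simp only [Matrix.mul_apply, charMatrixInv, charMatrix, Matrix.of_apply, hm']
  have h (χ : EvenCharacter d) : χ.1 (m : ZMod d) * ((d.totient : ℂ)⁻¹ * ∑ a : ZMod d,
      if absRep (g * d) ((g * a.val : ℕ) : ZMod (g * d)) = j.1 then χ.1⁻¹ a else 0) =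
      (d.totient : ℂ)⁻¹ * ∑ a : ZMod d,
      if absRep (g * d) ((g * a.val : ℕ) : ZMod (g * d)) = j.1 then
        χ.1 (m : ZMod d) * χ.1⁻¹ a else 0 := by
    simp_rw [mul_left_comm, Finset.mul_sum, mul_ite, mul_zero]
  simp_rw [h, ← Finset.mul_sum]
  rw [Finset.sum_comm]
  have h2 (a : ZMod d) : ∑ χ : EvenCharacter d,
      (if absRep (g * d) ((g * a.val : ℕ) : ZMod (g * d)) = j.1 then
        χ.1 (m : ZMod d) * χ.1⁻¹ a else 0) =
      (if absRep (g * d) ((g * a.val : ℕ) : ZMod (g * d)) = j.1 then (d.totient : ℂ) / 2 else 0) *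
       ((if a = (m : ZMod d) then 1 else 0) + if a = -(m : ZMod d) then 1 else 0) := by
    by_cases h1 : absRep (g * d) ((g * a.val : ℕ) : ZMod (g * d)) = j.1
    · simp only [h1, if_true, sum_evenCharacter_mul_inv hu]
    · simp only [h1, if_false, Finset.sum_const_zero, zero_mul]
  simp_rw [h2, mul_add, Finset.sum_add_distrib, mul_ite, mul_one, mul_zero,
    Finset.sum_ite_eq']
  have hi : absRep (g * d) ((g * m : ℕ) : ZMod (g * d)) = i.1 := by
    rw [← hm, absRep_natCast]
  rw [absRep_mul_congr hg (a := (m : ZMod d).val) (b := m) (by simp),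
    absRep_mul_congr hg (a := (-m : ZMod d).val) (b := m) (by simp), hi]
  simp only [Finset.mem_univ, if_true, Subtype.ext_iff]
  split_ifs
  · field_simp
    ring
  · simp

lemma dirichletMatrix_block_mul_charMatrix {k : ℕ} (hk : 2 ≤ k) (hg : g ≠ 0) :
    (dirichletMatrix k (g * d)).toSquareBlock (fun i => Nat.gcd i (g * d)) g * charMatrix g d =
      charMatrix g d *
        Matrix.diagonal fun χ : EvenCharacter d => DirichletCharacter.LFunction χ.1 k := by
  ext i χ
  obtain ⟨m, hm, hm', -⟩ := GcdIndex.exists_eq_mul i hg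
  rw [Matrix.mul_diagonal, Matrix.mul_apply]
  have h := sum_dirichletMatrix_mul hk i.1 (fun l : GcdIndex g d => l.1)
    (fun l => χ.1 (((l.1 : ℕ) / g : ℕ) : ZMod d))
  simp only [Matrix.toSquareBlock_def, Matrix.of_apply, charMatrix]
  refine h.trans ?_
  have hre : 1 < (k : ℂ).re := by
    rw [Complex.natCast_re]
    exact_mod_cast hk
  rw [DirichletCharacter.LFunction_eq_LSeries _ hre, LSeries, ← tsum_mul_left]
  refine tsum_congr fun n => ?_
  rw [hm, mul_left_comm, sum_ite_absRep_eq hg χ, Nat.mul_div_cancel_left _ (Nat.pos_of_ne_zero hg),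
    LSeries.term_def]
  split_ifs with hn
  · simp [hn, show k ≠ 0 by omega]
  · rw [Complex.cpow_natCast, Nat.cast_mul, map_mul]
    ring

lemma det_smul_dirichletMatrix_block {k : ℕ} (hk : 2 ≤ k) (hg : g ≠ 0) (c : ℂ) :
    ((c • dirichletMatrix k (g * d)).toSquareBlock (fun i => Nat.gcd i (g * d)) g).det =
      ∏ χ : EvenCharacter d, c * DirichletCharacter.LFunction χ.1 k := by
  have h : (c • dirichletMatrix k (g * d)).toSquareBlock (fun i => Nat.gcd i (g * d)) g *
      charMatrix g d = charMatrix g d *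
        Matrix.diagonal fun χ : EvenCharacter d => c * DirichletCharacter.LFunction χ.1 k := by
    have h1 : (Matrix.diagonal fun χ : EvenCharacter d => c * DirichletCharacter.LFunction χ.1 k) =
        c • Matrix.diagonal fun χ : EvenCharacter d => DirichletCharacter.LFunction χ.1 k :=
      Matrix.diagonal_smul c fun χ : EvenCharacter d => DirichletCharacter.LFunction χ.1 k
    rw [h1, Matrix.mul_smul, ← dirichletMatrix_block_mul_charMatrix hk hg, ← Matrix.smul_mul]
    rfl
  rw [← Matrix.det_diagonal, ← Matrix.det_conj_of_mul_eq_one (charMatrix_mul_charMatrixInv hg)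
    (charMatrixInv_mul_charMatrix hg), ← h, Matrix.mul_assoc, charMatrix_mul_charMatrixInv hg,
    Matrix.mul_one]

end Block

end DirichletMatrix

lemma evenCharLProd_eq_prod (k d : ℕ) [NeZero d] :
    evenCharLProd k d = ∏ χ : EvenCharacter d,
      ((-1 : ℂ) ^ (k / 2 + 1) * (Nat.factorial k) / (2 * Real.pi) ^ k) *
        DirichletCharacter.LFunction χ.1 k := by
  classical
  obtain ⟨n, rfl⟩ := Nat.exists_eq_succ_of_ne_zero (NeZero.ne d)
  rw [evenCharLProd, ← Finset.prod_filter]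
  exact Finset.prod_subtype _ (fun χ => by simp [DirichletCharacter.Even]) _

lemma image_gcd_eq_divisors (N : ℕ) [NeZero N] :
    Finset.univ.image (fun i : Fin (N / 2 + 1) => Nat.gcd i N) = N.divisors := by
  ext g
  simp only [Finset.mem_image, Finset.mem_univ, true_and, Nat.mem_divisors]
  constructor
  · rintro ⟨i, rfl⟩
    exact ⟨Nat.gcd_dvd_right _ _, NeZero.ne N⟩
  · rintro ⟨⟨d, hd⟩, hN⟩
    by_cases h : d = 1
    · exact ⟨0, by simp [hd, h]⟩
    · have hd0 : d ≠ 0 := by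
        rintro rfl
        simp [hd] at hN
      have h2 : g * 2 ≤ N := hd ▸ Nat.mul_le_mul_left g (by omega)
      exact ⟨⟨g, by omega⟩, Nat.gcd_eq_left ⟨d, hd⟩⟩

lemma det_smul_dirichletMatrix {N k : ℕ} [NeZero N] (hk : 2 ≤ k) :
    (((-1 : ℂ) ^ (k / 2 + 1) * (Nat.factorial k) / (2 * Real.pi) ^ k) •
      dirichletMatrix k N).det = ∏ d ∈ N.divisors, evenCharLProd k d := by
  set c := (-1 : ℂ) ^ (k / 2 + 1) * (Nat.factorial k) / (2 * Real.pi) ^ k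
  have hblock : (c • dirichletMatrix k N).BlockTriangular fun i => Nat.gcd i N := fun i j hij => by
    rw [Matrix.smul_apply, blockTriangular_dirichletMatrix k N hij, smul_zero]
  rw [hblock.det, image_gcd_eq_divisors, ← Nat.prod_div_divisors N (evenCharLProd k)]
  refine Finset.prod_congr rfl fun g hg => ?_
  obtain ⟨d, rfl⟩ := Nat.dvd_of_mem_divisors hg
  have hgd : g * d ≠ 0 := NeZero.ne _
  have hg0 : g ≠ 0 := left_ne_zero_of_mul hgd
  have : NeZero d := ⟨right_ne_zero_of_mul hgd⟩
  rw [det_smul_dirichletMatrix_block hk hg0, Nat.mul_div_cancel_left _ (Nat.pos_of_ne_zero hg0),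
    evenCharLProd_eq_prod]

lemma hasSum_periodicBernoulli {m : ℕ} (hm : m ≠ 0) (x : ℝ) :
    HasSum (fun n : ℕ => 1 / (n : ℝ) ^ (2 * m) * Real.cos (2 * Real.pi * n * x))
      ((-1 : ℝ) ^ (m + 1) * (2 * Real.pi) ^ (2 * m) / 2 / (Nat.factorial (2 * m)) *
        periodicBernoulli (2 * m) x) := by
  have h := hasSum_one_div_nat_pow_mul_cos hm
    (x := Int.fract x) ⟨Int.fract_nonneg x, (Int.fract_lt_one x).le⟩
  rw [Polynomial.eval_map_algebraMap] at h
  rw [periodicBernoulli, if_neg (by omega)]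
  convert h using 3 with n
  rw [← Real.cos_sub_int_mul_two_pi _ (n * ⌊x⌋), ← Int.self_sub_floor]
  congr 1
  push_cast
  ring

lemma map_bernoulliMatrixEven {N k : ℕ} [NeZero N] (hk : 2 ≤ k) (hke : Even k) :
    (bernoulliMatrixEven k N).map Complex.ofReal =
      (2 : ℂ) • ((((-1 : ℂ) ^ (k / 2 + 1) * (Nat.factorial k) / (2 * Real.pi) ^ k) •
        dirichletMatrix k N) * (cosMatrix N).map Complex.ofReal) := by
  obtain ⟨m, rfl⟩ := hke.two_dvd
  ext i j
  have hB := Complex.hasSum_ofReal.2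
    (hasSum_periodicBernoulli (show m ≠ 0 by omega) (((i : ℕ) * (j : ℕ) : ℕ) / (N : ℝ)))
  have hM := sum_dirichletMatrix_mul hk i id fun l => (cosMatrix N l j : ℂ)
  have hsum : ∑ l, dirichletMatrix (2 * m) N i l * (cosMatrix N l j : ℂ) =
      (((-1 : ℝ) ^ (m + 1) * (2 * Real.pi) ^ (2 * m) / 2 / (Nat.factorial (2 * m)) *
        periodicBernoulli (2 * m) (((i : ℕ) * (j : ℕ) : ℕ) / (N : ℝ)) : ℝ) : ℂ) := by
    rw [← hB.tsum_eq]
    refine hM.trans (tsum_congr fun n => ?_)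
    simp only [id, Finset.sum_ite_eq, Finset.mem_univ, if_true]
    rw [cosMatrix_apply, ZMod.apply_absRep (f := fun a => ZMod.cosChar (a * ((j : ℕ) : ZMod N)))
      (fun a => by rw [neg_mul, ZMod.cosChar_neg]), ← Nat.cast_mul, ZMod.cosChar_natCast]
    push_cast
    congr 3
    ring
  rw [Matrix.smul_mul, Matrix.smul_apply, Matrix.smul_apply, Matrix.mul_apply]
  simp only [Matrix.map_apply, bernoulliMatrixEven, Matrix.of_apply, smul_eq_mul]
  rw [hsum, Nat.mul_div_cancel_left _ two_pos]
  have hpi : (Real.pi : ℂ) ≠ 0 := Complex.ofReal_ne_zero.2 Real.pi_ne_zero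
  have hf : (Nat.factorial (2 * m) : ℂ) ≠ 0 := Nat.cast_ne_zero.2 (Nat.factorial_ne_zero _)
  have h1 : (-1 : ℂ) ^ (m + 1) * (-1) ^ (m + 1) = 1 := by rw [← mul_pow]; simp
  push_cast
  set P := (periodicBernoulli (2 * m) ((i : ℕ) * (j : ℕ) / (N : ℝ)) : ℂ)
  have h2 : (2 * (Real.pi : ℂ)) ^ (2 * m) ≠ 0 := pow_ne_zero _ (by simp [hpi])
  calc P = ((-1 : ℂ) ^ (m + 1) * (-1) ^ (m + 1)) * P := by rw [h1, one_mul]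
    _ = _ := by field_simp

/-- For `N ≥ 2` and even `k ≥ 2`,
`det(B_{k,N}) = (−1)^{N⁺(N⁺+1)/2} · N^{(N⁺+1)/2} · 2^{N⁺+1−N⁻} ·
∏_{d ∣ N} ∏_{χ even mod d} ((−1)^{k/2+1}·k!/(2π)^k · L(k,χ))`. -/
theorem det_bernoulliMatrixEven (N k : ℕ) (hN : 2 ≤ N) (hk : 2 ≤ k) (hke : Even k) :
    ((bernoulliMatrixEven k N).det : ℂ) =
      (-1 : ℂ) ^ (N / 2 * (N / 2 + 1) / 2) * (Real.sqrt N : ℂ) ^ (N / 2 + 1) *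
        2 ^ (N / 2 + 1 - (N - 1) / 2) *
        ∏ d ∈ N.divisors, evenCharLProd k d := by
  have : NeZero N := ⟨by omega⟩
  have h1 : ((bernoulliMatrixEven k N).det : ℂ) =
      ((bernoulliMatrixEven k N).map Complex.ofReal).det :=
    Complex.ofRealHom.map_det (bernoulliMatrixEven k N)
  have h2 : (((cosMatrix N).map Complex.ofReal).det : ℂ) = ((cosMatrix N).det : ℂ) :=
    (Complex.ofRealHom.map_det (cosMatrix N)).symm
  have h3 := congrArg Complex.ofReal (det_cosMatrix hN)
  push_cast at h3
  rw [h1, map_bernoulliMatrixEven hk hke, Matrix.det_smul, Matrix.det_mul,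
    det_smul_dirichletMatrix hk, h2, Fintype.card_fin, ← h3]
  have h4 : (2 : ℂ) ^ (N / 2 + 1) = 2 ^ ((N - 1) / 2) * 2 ^ (N / 2 + 1 - (N - 1) / 2) := by
    rw [← pow_add]
    congr 1
    omega
  rw [h4]
  ring
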